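/- Let M be a tame refinement monoid and a, b, c, d1, d2 ∈ M. Then: (1) if a + c ≤ b + c, there exists a1 ∈ M such that a1 + c = c and a ≤ b + a1; (2) if a ≤ c + d1 and a ≤ c + d2, there exists d ∈ M such that a ≤ c + d and d ≤ d1 and d ≤ d2. -/

import Mathlib

/-- A commutative monoid satisfies the Riesz refinement property if every equation
`x1 + x2 = y1 + y2` admits a refinement matrix. -/
def IsRefinementAddMonoid (M : Type*) [AddCommMonoid M] : Prop :=
  ∀ x1 x2 y1 y2 : M, x1 + x2 = y1 + y2 →
    ∃ z11 z12 z21 z22 : M,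
      x1 = z11 + z12 ∧ x2 = z21 + z22 ∧ y1 = z11 + z21 ∧ y2 = z12 + z22

/-- The algebraic (minimal) ordering on a commutative monoid: `x ≤ y` iff `x + z = y`
for some `z`. -/
def AlgLE {M : Type*} [AddCommMonoid M] (x y : M) : Prop := ∃ z, x + z = y

/-- A witness that the inclusion of the submonoid `S` into `M` factors through a
finitely generated refinement monoid. -/
structure TameWitness (M : Type*) [AddCommMonoid M] (S : AddSubmonoid M) where
  N : Type
  [instN : AddCommMonoid N]
  fg : AddMonoid.FG N
  refinement : IsRefinementAddMonoid N
  f : ↥S →+ N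
  g : N →+ M
  factors : ∀ s : ↥S, g (f s) = (s : M)

/-- A (refinement) monoid is tame if for each finitely generated submonoid `S ⊆ M`, the
inclusion map `S → M` factors through a finitely generated refinement monoid. -/
def IsTame (M : Type*) [AddCommMonoid M] : Prop :=
  ∀ S : AddSubmonoid M, S.FG → Nonempty (TameWitness M S)

theorem fg_wqo {N : Type*} [AddCommMonoid N] (h : AddMonoid.FG N) (c : ℕ → N) :
    ∃ n m, n < m ∧ AlgLE (c n) (c m) := by
  obtain ⟨S, hS⟩ := h.fg_top
  have hx : ∀ x : N, ∃ f : S → ℕ, ∑ i, f i • (i : N) = x := by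
    intro x
    have hm : x ∈ AddSubmonoid.closure (S : Set N) := by rw [hS]; trivial
    induction hm using AddSubmonoid.closure_induction with
    | mem y hy =>
      classical
      refine ⟨Pi.single ⟨y, hy⟩ 1, ?_⟩
      rw [Finset.sum_eq_single (⟨y, hy⟩ : S)]
      · simp
      · intro j _ hj
        simp [Pi.single_eq_of_ne hj]
      · simp
    | zero => exact ⟨0, by simp⟩
    | add y z _ _ hy hz =>
      obtain ⟨f, rfl⟩ := hy
      obtain ⟨g, rfl⟩ := hz
      exact ⟨f + g, by simp [add_smul, Finset.sum_add_distrib]⟩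
  choose F hF using hx
  have hw : WellQuasiOrdered (α := S → ℕ) (· ≤ ·) := wellQuasiOrdered_le
  obtain ⟨n, m, hnm, hle⟩ := hw (fun k => F (c k))
  refine ⟨n, m, hnm, ∑ i, (F (c m) i - F (c n) i) • (i : N), ?_⟩
  have e : ∑ i, F (c n) i • (i : N) + ∑ i, (F (c m) i - F (c n) i) • (i : N)
      = ∑ i, F (c m) i • (i : N) := by
    rw [← Finset.sum_add_distrib]
    refine Finset.sum_congr rfl fun i _ => ?_
    rw [← add_smul, Nat.add_sub_cancel' (hle i)]
  rwa [hF, hF] at e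

theorem key {N : Type*} [AddCommMonoid N] (href : IsRefinementAddMonoid N)
    (hw : ∀ c : ℕ → N, ∃ n m, n < m ∧ AlgLE (c n) (c m))
    (a b c : N) (h : c + a = c + b) :
    ∃ d a' b' e, a = d + a' ∧ b = d + b' ∧ AlgLE a' e ∧ AlgLE b' e ∧ e + c = c := by
  let T := {p : N × N × N // p.2.2 + p.1 = p.2.2 + p.2.1}
  have hstep : ∀ s : T, ∃ t : T, (∃ d, s.1.1 = d + t.1.1 ∧ s.1.2.1 = d + t.1.2.1) ∧
      s.1.2.2 = t.1.1 + t.1.2.2 ∧ s.1.2.2 = t.1.2.1 + t.1.2.2 := by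
    rintro ⟨⟨a, b, c⟩, hs⟩
    obtain ⟨c1, a1, b1, d, h1, h2, h3, h4⟩ := href c b c a hs.symm
    -- c = c1 + a1, b = b1 + d, c = c1 + b1, a = a1 + d
    refine ⟨⟨(a1, b1, c1), ?_⟩, ⟨d, ?_, ?_⟩, ?_, ?_⟩
    · exact h1.symm.trans h3
    · exact h4.trans (add_comm _ _)
    · exact h2.trans (add_comm _ _)
    · exact h1.trans (add_comm _ _)
    · exact h3.trans (add_comm _ _)
  choose nx hd ha hb using hstep
  let q : ℕ → T := fun n => nx^[n] ⟨(a, b, c), h⟩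
  have hq : ∀ n, q (n + 1) = nx (q n) := fun n => Function.iterate_succ_apply' _ _ _
  have hA : ∀ n, ∃ d, a = d + (q n).1.1 ∧ b = d + (q n).1.2.1 := by
    intro n
    induction n with
    | zero => exact ⟨0, by simp [q], by simp [q]⟩
    | succ n ih =>
      obtain ⟨d, h1, h2⟩ := ih
      obtain ⟨d', h3, h4⟩ := hd (q n)
      refine ⟨d + d', ?_, ?_⟩
      · rw [hq, add_assoc, ← h3, ← h1]
      · rw [hq, add_assoc, ← h4, ← h2]
  have hC : ∀ n k, ∃ t, (q n).1.2.2 = (q (n + k)).1.2.2 + t := by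
    intro n k
    induction k with
    | zero => exact ⟨0, by simp⟩
    | succ k ih =>
      obtain ⟨t, ht⟩ := ih
      refine ⟨(q (n + k + 1)).1.1 + t, ?_⟩
      rw [ht, ha (q (n + k)), ← hq, ← add_assoc n k 1]
      abel
  obtain ⟨n, m, hnm, s, hs⟩ := hw (fun n => (q n).1.2.2)
  obtain ⟨k, rfl⟩ := Nat.exists_eq_add_of_lt hnm
  obtain ⟨d, h1, h2⟩ := hA (n + k + 1)
  obtain ⟨t, ht⟩ := hC n k
  obtain ⟨r, hr⟩ := hC 0 n
  have ha' := ha (q (n + k))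
  have hb' := hb (q (n + k))
  rw [← hq] at ha' hb'
  simp only [zero_add] at hr
  have h0 : (q 0).1.2.2 = c := rfl
  rw [h0] at hr
  generalize (q (n + k + 1)).1.1 = A at *
  generalize (q (n + k + 1)).1.2.1 = B at *
  generalize (q (n + k + 1)).1.2.2 = C at *
  generalize (q n).1.2.2 = D at *
  generalize (q (n + k)).1.2.2 = E at *
  have e1 : A + (t + s) + D = D := by
    conv_rhs => rw [ht, ha', ← hs]
    abel
  have e2 : B + (t + s) + D = D := by
    conv_rhs => rw [ht, hb', ← hs]
    abel
  refine ⟨d, A, B, (A + (t + s)) + (B + (t + s)), h1, h2, ⟨(t + s) + (B + (t + s)), by abel⟩,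
    ⟨(A + (t + s)) + (t + s), by abel⟩, ?_⟩
  rw [hr, ← add_assoc, add_assoc (A + (t + s)), e2, e1]

theorem part1 {N : Type*} [AddCommMonoid N] (href : IsRefinementAddMonoid N)
    (hw : ∀ c : ℕ → N, ∃ n m, n < m ∧ AlgLE (c n) (c m))
    (a b c : N) (h : AlgLE (a + c) (b + c)) : ∃ a1 : N, a1 + c = c ∧ AlgLE a (b + a1) := by
  obtain ⟨z, hz⟩ := h
  obtain ⟨d, a', b', e, h1, h2, ⟨r, h3⟩, -, h5⟩ := key href hw (a + z) b c (by
    rw [add_comm c b, ← hz]; abel)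
  refine ⟨e, h5, z + b' + r, ?_⟩
  rw [← h3, h2, ← add_assoc, ← add_assoc, h1]
  abel

theorem part2 {N : Type*} [AddCommMonoid N] (href : IsRefinementAddMonoid N)
    (hw : ∀ c : ℕ → N, ∃ n m, n < m ∧ AlgLE (c n) (c m))
    (a c d1 d2 : N) (h1 : AlgLE a (c + d1)) (h2 : AlgLE a (c + d2)) :
    ∃ d : N, AlgLE a (c + d) ∧ AlgLE d d1 ∧ AlgLE d d2 := by
  obtain ⟨k1, h1⟩ := h1
  obtain ⟨k2, h2⟩ := h2
  obtain ⟨c', e1, u, f1, ha1, -, hc1, hd1⟩ := href _ _ _ _ h1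
  obtain ⟨c'', e2, v, f2, ha2, -, hc2, hd2⟩ := href _ _ _ _ h2
  obtain ⟨x, y, z, w, rfl, rfl, rfl, rfl⟩ := href _ _ _ _ (ha1.symm.trans ha2)
  obtain ⟨d, β, α, e, hy, hz, ⟨s1, he1⟩, ⟨s2, he2⟩, hex⟩ := key href hw (y + u) (z + v) x (by
    rw [← add_assoc, ← add_assoc, ← hc1, ← hc2])
  obtain ⟨y1, y2, u1, u2, rfl, rfl, hdy, rfl⟩ := href _ _ _ _ hy
  obtain ⟨z1, z2, v1, v2, rfl, rfl, hdz, rfl⟩ := href _ _ _ _ hz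
  obtain ⟨p, q, r, s, rfl, rfl, rfl, rfl⟩ := href _ _ _ _ (hdy.symm.trans hdz)
  have hx : x = y2 + z2 + (u2 + v2 + s1 + s2) + x := by
    conv_lhs => rw [← hex, ← hex]
    conv_lhs => rw [← he1]
    have : y2 + u2 + s1 + (y2 + u2 + s1 + x) = y2 + u2 + s1 + (z2 + v2 + s2 + x) := by
      rw [he1, he2]
    rw [this]; abel
  refine ⟨p + w, ⟨u2 + v2 + s1 + s2 + s + y2 + u2, ?_⟩, ⟨r + z2 + f1, ?_⟩,
    ⟨q + y2 + f2, ?_⟩⟩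
  · rw [ha1, hc1]
    conv_rhs => rw [hx]
    abel
  · rw [hd1]; abel
  · rw [hd2]; abel

theorem AlgLE.map' {N M : Type*} [AddCommMonoid N] [AddCommMonoid M] (g : N →+ M) {x y : N}
    (h : AlgLE x y) : AlgLE (g x) (g y) := by
  obtain ⟨z, rfl⟩ := h
  exact ⟨g z, (map_add g x z).symm⟩

/-- Two further consequences of tameness for a refinement monoid `M`. -/
theorem tame_further_properties
    (M : Type*) [AddCommMonoid M] (href : IsRefinementAddMonoid M) (htame : IsTame M)
    (a b c d1 d2 : M) :
    (AlgLE (a + c) (b + c) → ∃ a1 : M, a1 + c = c ∧ AlgLE a (b + a1)) ∧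
    (AlgLE a (c + d1) → AlgLE a (c + d2) →
      ∃ d : M, AlgLE a (c + d) ∧ AlgLE d d1 ∧ AlgLE d d2) := by
  constructor
  · rintro ⟨z, hz⟩
    obtain ⟨W⟩ := htame (AddSubmonoid.closure {a, b, c, z})
      ⟨_, congrArg _ (Set.Finite.coe_toFinset (Set.toFinite {a, b, c, z}))⟩
    obtain ⟨N, fg, ref, f, g, hfg⟩ := W
    let A : AddSubmonoid.closure {a, b, c, z} := ⟨a, AddSubmonoid.subset_closure (by simp)⟩
    let B : AddSubmonoid.closure {a, b, c, z} := ⟨b, AddSubmonoid.subset_closure (by simp)⟩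
    let C : AddSubmonoid.closure {a, b, c, z} := ⟨c, AddSubmonoid.subset_closure (by simp)⟩
    let Z : AddSubmonoid.closure {a, b, c, z} := ⟨z, AddSubmonoid.subset_closure (by simp)⟩
    have h : A + C + Z = B + C := Subtype.ext hz
    obtain ⟨a1, h1, h2⟩ := part1 ref (fg_wqo fg) (f A) (f B) (f C)
      ⟨f Z, by rw [← map_add, ← map_add, h, map_add]⟩
    refine ⟨g a1, ?_, ?_⟩
    · have := congrArg g h1
      rwa [map_add, hfg] at this
    · have := h2.map' g
      rwa [map_add, hfg, hfg] at this
  · rintro ⟨y, hy⟩ ⟨z, hz⟩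
    let G : Set M := {a, c, d1, d2, y, z}
    obtain ⟨W⟩ := htame (AddSubmonoid.closure G)
      ⟨_, congrArg _ (Set.Finite.coe_toFinset (Set.toFinite G))⟩
    obtain ⟨N, fg, ref, f, g, hfg⟩ := W
    let A : AddSubmonoid.closure G := ⟨a, AddSubmonoid.subset_closure (by simp [G])⟩
    let C : AddSubmonoid.closure G := ⟨c, AddSubmonoid.subset_closure (by simp [G])⟩
    let D1 : AddSubmonoid.closure G := ⟨d1, AddSubmonoid.subset_closure (by simp [G])⟩
    let D2 : AddSubmonoid.closure G := ⟨d2, AddSubmonoid.subset_closure (by simp [G])⟩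
    let Y : AddSubmonoid.closure G := ⟨y, AddSubmonoid.subset_closure (by simp [G])⟩
    let Z : AddSubmonoid.closure G := ⟨z, AddSubmonoid.subset_closure (by simp [G])⟩
    have h1 : A + Y = C + D1 := Subtype.ext hy
    have h2 : A + Z = C + D2 := Subtype.ext hz
    obtain ⟨d, k1, k2, k3⟩ := part2 ref (fg_wqo fg) (f A) (f C) (f D1) (f D2)
      ⟨f Y, by rw [← map_add, h1, map_add]⟩ ⟨f Z, by rw [← map_add, h2, map_add]⟩
    have k1 := k1.map' g
    have k2 := k2.map' g
    have k3 := k3.map' g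
    rw [map_add, hfg, hfg] at k1
    rw [hfg] at k2 k3
    exact ⟨g d, k1, k2, k3⟩
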